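/- Let β ≥ 2 be an integer, λ > 1 and δ > 0. Let v : ℝ → ℝ satisfy v(x + 2πβ) = v(x) + 2π for all x and 0 < v'(x) ≤ λ⁻¹ for all real x, and suppose v extends to a holomorphic function on the closed strip {z ∈ ℂ : |Im z| ≤ δ} with v' nonvanishing there and sup_{|Im z| ≤ δ} |v''(z)/v'(z)| ≤ C_{1,δ} < ∞. Define (Lφ)(x) = Σ_{b=0}^{β−1} v'(x + 2πb) φ(v(x + 2πb)) on 2π-periodic functions. Assume: (spectral gap) there exist C₀ > 0 and θ ∈ (0,1) such that for every 2π-periodic function ψ of bounded variation with ∫₀^{2π} ψ = 0 one has ‖Lⁿψ‖_BV ≤ C₀ θⁿ ‖ψ‖_BV for all n ∈ ℕ; and ρ is a 2π-periodic function of bounded variation with Lρ = ρ and ∫₀^{2π} ρ(x) dx = 1. Then there exist N₀ ∈ ℕ, C > 0 and ζ ∈ (0,δ] such that for every N ≥ N₀ there is a unique trigonometric polynomial ρ_N of degree at most N satisfying ρ_N − P_N(Lρ_N) + (1/2π)·(∫₀^{2π} ρ_N(t) dt) = 1/(2π) identically, and moreover ‖ρ_N − ρ‖_BV ≤ C ·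 N^{3/2} e^{−ζN}. -/

import Mathlib

/-- The `j`-th Fourier coefficient of a `2π`-periodic function `φ : ℝ → ℂ`. -/
noncomputable def fCoeff (φ : ℝ → ℂ) (j : ℤ) : ℂ :=
  (1 / (2 * Real.pi) : ℂ) * ∫ x in (0 : ℝ)..(2 * Real.pi),
    φ x * Complex.exp (-Complex.I * (j : ℂ) * (x : ℂ))

/-- The `N`-th Fourier truncation `P_N φ = Σ_{|j| ≤ N} φ̂(j) e^{ijx}`. -/
noncomputable def fTrunc (N : ℕ) (φ : ℝ → ℂ) : ℝ → ℂ := fun x =>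
  ∑ j ∈ Finset.Icc (-(N : ℤ)) (N : ℤ), fCoeff φ j * Complex.exp (Complex.I * (j : ℂ) * (x : ℂ))

/-- The BV norm of a `2π`-periodic function:
`‖φ‖_BV = sup_{[0,2π]} |φ| + Var_{[0,2π]} φ`. -/
noncomputable def bvNorm (φ : ℝ → ℂ) : ℝ :=
  (⨆ x : Set.Icc (0 : ℝ) (2 * Real.pi), ‖φ (x : ℝ)‖) +
    (eVariationOn φ (Set.Icc 0 (2 * Real.pi))).toReal

/-- The transfer operator `(L φ)(x) = Σ_{b=0}^{β-1} v'(x + 2πb) φ(v(x + 2πb))` of a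
degree-`β` expanding circle map with inverse lift `v`. -/
noncomputable def transferOp (β : ℕ) (v : ℝ → ℝ) (φ : ℝ → ℂ) : ℝ → ℂ := fun x =>
  ∑ b ∈ Finset.range β,
    ((deriv v (x + 2 * Real.pi * b) : ℝ) : ℂ) * φ (v (x + 2 * Real.pi * b))

/-- `φ` is a trigonometric polynomial of degree at most `N`. -/
def IsTrigPoly (N : ℕ) (φ : ℝ → ℂ) : Prop :=
  ∃ c : ℤ → ℂ, φ = fun x : ℝ =>
    ∑ j ∈ Finset.Icc (-(N : ℤ)) (N : ℤ), c j * Complex.exp (Complex.I * (j : ℂ) * (x : ℂ))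

open MeasureTheory

/-- The interval `[0, 2π]`. -/
local notation "J" => Set.Icc (0 : ℝ) (2 * Real.pi)

section BoundedVariation

theorem eVariationOn_add_le (f g : ℝ → ℂ) (s : Set ℝ) :
    eVariationOn (fun x => f x + g x) s ≤ eVariationOn f s + eVariationOn g s := by
  refine iSup_le fun p => ?_
  calc ∑ i ∈ Finset.range p.1, edist (f (p.2.1 (i + 1)) + g (p.2.1 (i + 1)))
        (f (p.2.1 i) + g (p.2.1 i))
      ≤ ∑ i ∈ Finset.range p.1, (edist (f (p.2.1 (i + 1))) (f (p.2.1 i)) +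
          edist (g (p.2.1 (i + 1))) (g (p.2.1 i))) :=
        Finset.sum_le_sum fun i _ => edist_add_add_le _ _ _ _
    _ ≤ _ := by
        rw [Finset.sum_add_distrib]
        exact add_le_add (le_iSup_of_le p le_rfl) (le_iSup_of_le p le_rfl)

theorem BoundedVariationOn.fun_add {f g : ℝ → ℂ} {s : Set ℝ} (hf : BoundedVariationOn f s)
    (hg : BoundedVariationOn g s) : BoundedVariationOn (fun x => f x + g x) s :=
  ((eVariationOn_add_le f g s).trans_lt (ENNReal.add_lt_top.2 ⟨hf.lt_top, hg.lt_top⟩)).ne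

theorem BoundedVariationOn.const_mul {f : ℝ → ℂ} {s : Set ℝ} (hf : BoundedVariationOn f s)
    (c : ℂ) : BoundedVariationOn (fun x => c * f x) s :=
  ((lipschitzWith_smul c).lipschitzOnWith (s := Set.univ)).comp_boundedVariationOn
    (Set.mapsTo_univ _ _) hf

theorem bvNorm_nonneg (f : ℝ → ℂ) : 0 ≤ bvNorm f :=
  add_nonneg (Real.iSup_nonneg fun _ => norm_nonneg _) ENNReal.toReal_nonneg

theorem BoundedVariationOn.bddAbove_norm {f : ℝ → ℂ} (hf : BoundedVariationOn f J) :
    BddAbove (Set.range fun x : J => ‖f (x : ℝ)‖) := by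
  refine ⟨‖f 0‖ + (eVariationOn f J).toReal, ?_⟩
  rintro _ ⟨⟨x, hx⟩, rfl⟩
  have h0 : (0 : ℝ) ∈ J := ⟨le_rfl, by positivity⟩
  have h := hf.dist_le hx h0
  rw [dist_eq_norm] at h
  have := norm_le_norm_add_norm_sub' (f x) (f 0)
  simp only
  linarith

theorem norm_le_bvNorm {f : ℝ → ℂ} (hf : BoundedVariationOn f J) {x : ℝ} (hx : x ∈ J) :
    ‖f x‖ ≤ bvNorm f :=
  (le_ciSup hf.bddAbove_norm ⟨x, hx⟩).trans (le_add_of_nonneg_right ENNReal.toReal_nonneg)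

theorem nonempty_period_interval : Nonempty J := ⟨⟨0, le_rfl, by positivity⟩⟩

theorem bvNorm_add_le {f g : ℝ → ℂ} (hf : BoundedVariationOn f J)
    (hg : BoundedVariationOn g J) : bvNorm (fun x => f x + g x) ≤ bvNorm f + bvNorm g := by
  have := nonempty_period_interval
  have h1 : (⨆ x : J, ‖f (x : ℝ) + g x‖) ≤ (⨆ x : J, ‖f (x : ℝ)‖) + ⨆ x : J, ‖g (x : ℝ)‖ :=
    ciSup_le fun x => (norm_add_le _ _).trans
      (add_le_add (le_ciSup hf.bddAbove_norm x) (le_ciSup hg.bddAbove_norm x))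
  have h2 : (eVariationOn (fun x => f x + g x) J).toReal ≤
      (eVariationOn f J).toReal + (eVariationOn g J).toReal := by
    rw [← ENNReal.toReal_add hf hg]
    exact ENNReal.toReal_mono (ENNReal.add_ne_top.2 ⟨hf, hg⟩) (eVariationOn_add_le f g J)
  unfold bvNorm
  linarith

theorem eVariationOn_le_of_lipschitz {f : ℝ → ℂ} {B : NNReal} (hf : LipschitzOnWith B f J) :
    eVariationOn f J ≤ B * ENNReal.ofReal (2 * Real.pi) := by
  have h0 : (0 : ℝ) ∈ J := ⟨le_rfl, by positivity⟩
  have h1 : 2 * Real.pi ∈ J := ⟨by positivity, le_rfl⟩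
  have h := hf.comp_eVariationOn_le (f := f) (g := fun x : ℝ => x) (s := J) (fun x hx => hx)
  refine h.trans (mul_le_mul_right ?_ _)
  have h2 := (monotoneOn_id (α := ℝ) (s := J)).eVariationOn_eq h0 h1
  rw [Set.inter_self, id, id, sub_zero] at h2
  exact h2.le

theorem LipschitzOnWith.boundedVariationOn_period {f : ℝ → ℂ} {B : NNReal}
    (hf : LipschitzOnWith B f J) : BoundedVariationOn f J :=
  ((eVariationOn_le_of_lipschitz hf).trans_lt
    (ENNReal.mul_lt_top ENNReal.coe_lt_top ENNReal.ofReal_lt_top)).ne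

theorem bvNorm_le_of_lipschitz {f : ℝ → ℂ} {A : ℝ} {B : NNReal} (hA : ∀ x ∈ J, ‖f x‖ ≤ A)
    (hf : LipschitzOnWith B f J) : bvNorm f ≤ A + 2 * Real.pi * B := by
  have := nonempty_period_interval
  refine add_le_add (ciSup_le fun x => hA x x.2) ?_
  have h := ENNReal.toReal_mono (by finiteness) (eVariationOn_le_of_lipschitz hf)
  rw [ENNReal.toReal_mul, ENNReal.toReal_ofReal (by positivity)] at h
  simpa [mul_comm] using h

theorem ContDiff.boundedVariationOn_period {f : ℝ → ℂ} (hf : ContDiff ℝ 1 f) :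
    BoundedVariationOn f J := by
  obtain ⟨K, hK⟩ := hf.locallyLipschitz.locallyLipschitzOn.exists_lipschitzOnWith_of_compact
    (s := J) isCompact_Icc
  exact hK.boundedVariationOn_period

theorem bvNorm_zero : bvNorm (fun _ => 0) = 0 := by
  have h : LipschitzOnWith 0 (fun _ : ℝ => (0 : ℂ)) J := (LipschitzWith.const 0).lipschitzOnWith
  have := bvNorm_le_of_lipschitz (A := 0) (by simp) h
  simp only [NNReal.coe_zero, mul_zero, add_zero] at this
  exact le_antisymm this (bvNorm_nonneg _)

end BoundedVariation

section Fourier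

/-- The Fourier mode `x ↦ e^{ijx}`. -/
noncomputable def fMode (j : ℤ) (x : ℝ) : ℂ := Complex.exp (Complex.I * (j : ℂ) * (x : ℂ))

/-- The trigonometric polynomial of degree at most `N` with coefficients `c`. -/
noncomputable def trigPoly (N : ℕ) (c : ℤ → ℂ) (x : ℝ) : ℂ :=
  ∑ j ∈ Finset.Icc (-(N : ℤ)) (N : ℤ), c j * fMode j x

theorem contDiff_fMode (j : ℤ) : ContDiff ℝ 1 (fMode j) :=
  Complex.contDiff_exp.comp (contDiff_const.mul Complex.ofRealCLM.contDiff)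

theorem contDiff_trigPoly (N : ℕ) (c : ℤ → ℂ) : ContDiff ℝ 1 (trigPoly N c) :=
  ContDiff.sum fun j _ => contDiff_const.mul (contDiff_fMode j)

theorem norm_fMode (j : ℤ) (x : ℝ) : ‖fMode j x‖ = 1 := by
  rw [fMode, show Complex.I * (j : ℂ) * (x : ℂ) = ((j * x : ℝ) : ℂ) * Complex.I by
    push_cast; ring, Complex.norm_exp_ofReal_mul_I]

theorem fMode_add_period (j n : ℤ) (x : ℝ) : fMode j (x + 2 * Real.pi * n) = fMode j x := by
  refine Complex.exp_eq_exp_iff_exists_int.2 ⟨j * n, ?_⟩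
  push_cast
  ring

theorem fMode_mul (j k : ℤ) (x : ℝ) : fMode j x * fMode k x = fMode (j + k) x := by
  rw [fMode, fMode, fMode, ← Complex.exp_add]
  push_cast
  ring_nf

theorem fCoeff_eq (φ : ℝ → ℂ) (j : ℤ) :
    fCoeff φ j = (1 / (2 * Real.pi) : ℂ) * ∫ x in (0 : ℝ)..(2 * Real.pi), φ x * fMode (-j) x := by
  simp [fCoeff, fMode]

theorem dist_fMode_le (j : ℤ) (x y : ℝ) : ‖fMode j x - fMode j y‖ ≤ |(j : ℝ)| * |x - y| := by
  have hd : ∀ t : ℝ, HasDerivAt (fMode j) (fMode j t * (Complex.I * j)) t := fun t => by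
    have h := ((hasDerivAt_id (t : ℂ)).const_mul (Complex.I * (j : ℂ))).cexp.comp_ofReal
    rw [mul_one] at h
    exact h
  have h := (convex_univ (𝕜 := ℝ) (E := ℝ)).norm_image_sub_le_of_norm_hasDerivWithin_le
    (f := fMode j) (C := |(j : ℝ)|) (fun t _ => (hd t).hasDerivWithinAt)
    (fun t _ => by simp [norm_fMode]) (Set.mem_univ y) (Set.mem_univ x)
  simpa using h

theorem integral_fMode (k : ℤ) :
    ∫ x in (0 : ℝ)..(2 * Real.pi), fMode k x = if k = 0 then 2 * (Real.pi : ℂ) else 0 := by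
  split_ifs with h
  · simp [fMode, h]
  · unfold fMode
    rw [integral_exp_mul_complex (by simpa using h)]
    have := fMode_add_period k 1 0
    simp only [fMode] at this
    simp at this
    simp [this]

theorem fCoeff_fMode (k j : ℤ) : fCoeff (fMode k) j = if k = j then 1 else 0 := by
  have hpi : (Real.pi : ℂ) ≠ 0 := by exact_mod_cast Real.pi_ne_zero
  rw [fCoeff_eq]
  simp_rw [fMode_mul]
  rw [integral_fMode]
  by_cases h : k = j
  · subst h
    simp
    field_simp
  · rw [if_neg h, if_neg (by omega), mul_zero]

theorem fCoeff_sum {ι : Type*} (s : Finset ι) (c : ι → ℂ) (f : ι → ℝ → ℂ)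
    (hf : ∀ i ∈ s, Continuous (f i)) (j : ℤ) :
    fCoeff (fun x => ∑ i ∈ s, c i * f i x) j = ∑ i ∈ s, c i * fCoeff (f i) j := by
  simp_rw [fCoeff_eq, Finset.sum_mul]
  rw [intervalIntegral.integral_finsetSum, Finset.mul_sum]
  · refine Finset.sum_congr rfl fun i _ => ?_
    simp_rw [mul_assoc (c i)]
    rw [intervalIntegral.integral_const_mul]
    ring
  · intro i hi
    exact ((continuous_const.mul (hf i hi)).mul (contDiff_fMode _).continuous).intervalIntegrable
      _ _

theorem fCoeff_trigPoly (N : ℕ) (c : ℤ → ℂ) (j : ℤ) :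
    fCoeff (trigPoly N c) j = if j ∈ Finset.Icc (-(N : ℤ)) (N : ℤ) then c j else 0 := by
  unfold trigPoly
  rw [fCoeff_sum _ _ _ fun i _ => (contDiff_fMode i).continuous]
  simp [fCoeff_fMode]

theorem fTrunc_eq_trigPoly (N : ℕ) (φ : ℝ → ℂ) : fTrunc N φ = trigPoly N (fCoeff φ) := rfl

theorem integral_eq_fCoeff_zero (φ : ℝ → ℂ) :
    ∫ x in (0 : ℝ)..(2 * Real.pi), φ x = 2 * Real.pi * fCoeff φ 0 := by
  have hpi : (Real.pi : ℂ) ≠ 0 := by exact_mod_cast Real.pi_ne_zero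
  simp [fCoeff]
  field_simp

theorem norm_fCoeff_le_bvNorm {φ : ℝ → ℂ} (hφ : BoundedVariationOn φ J) (j : ℤ) :
    ‖fCoeff φ j‖ ≤ bvNorm φ := by
  have hpi := Real.pi_pos
  have h : ‖∫ x in (0 : ℝ)..(2 * Real.pi), φ x * fMode (-j) x‖ ≤
      bvNorm φ * |2 * Real.pi - 0| := by
    refine intervalIntegral.norm_integral_le_of_norm_le_const fun x hx => ?_
    rw [Set.uIoc_of_le (by positivity)] at hx
    rw [norm_mul, norm_fMode, mul_one]
    exact norm_le_bvNorm hφ ⟨hx.1.le, hx.2⟩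
  rw [fCoeff_eq, norm_mul]
  have h1 : ‖(1 / (2 * Real.pi) : ℂ)‖ = 1 / (2 * Real.pi) := by
    simp [abs_of_pos hpi]
  rw [h1]
  rw [sub_zero, abs_of_pos (by positivity)] at h
  calc _ ≤ 1 / (2 * Real.pi) * (bvNorm φ * (2 * Real.pi)) := by gcongr
    _ = _ := by field_simp

theorem hasSum_fCoeff_mul_fMode {g : ℝ → ℂ} (hg : Continuous g)
    (hper : ∀ x, g (x + 2 * Real.pi) = g x) (hsum : Summable (fCoeff g)) (x : ℝ) :
    HasSum (fun j => fCoeff g j * fMode j x) (g x) := by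
  have : Fact (0 < 2 * Real.pi) := ⟨by positivity⟩
  have hper' : Function.Periodic g (2 * Real.pi) := hper
  let G : C(AddCircle (2 * Real.pi), ℂ) := ⟨hper'.lift, continuous_coinduced_dom.2 hg⟩
  have hG : ∀ y : ℝ, G (y : AddCircle (2 * Real.pi)) = g y := fun y => hper'.lift_coe y
  have hpi : (Real.pi : ℂ) ≠ 0 := by exact_mod_cast Real.pi_ne_zero
  have hfour : ∀ (n : ℤ) (y : ℝ), fourier n (y : AddCircle (2 * Real.pi)) = fMode n y := by
    intro n y
    rw [fourier_coe_apply, fMode]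
    congr 1
    push_cast
    field_simp
  have hco : fourierCoeff G = fCoeff g := by
    funext j
    rw [fourierCoeff_eq_intervalIntegral _ _ 0, fCoeff_eq, zero_add]
    simp_rw [hfour, hG, smul_eq_mul, mul_comm (fMode _ _)]
    rw [Complex.real_smul]
    push_cast
    rfl
  have := has_pointwise_sum_fourier_series_of_summable (f := G) (by rwa [hco]) x
  simpa only [hco, hfour, hG, smul_eq_mul] using this

theorem bvNorm_le_tsum {g : ℝ → ℂ} {a : ℤ → ℂ}
    (ha : Summable fun j : ℤ => ‖a j‖ * (1 + 2 * Real.pi * |(j : ℝ)|))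
    (hg : ∀ x, HasSum (fun j => a j * fMode j x) (g x)) :
    bvNorm g ≤ ∑' j : ℤ, ‖a j‖ * (1 + 2 * Real.pi * |(j : ℝ)|) := by
  have hpi := Real.pi_pos
  have h0 : Summable fun j : ℤ => ‖a j‖ := by
    refine Summable.of_nonneg_of_le (fun _ => norm_nonneg _) (fun j => ?_) ha
    refine le_mul_of_one_le_right (norm_nonneg _) ?_
    have := mul_nonneg (by positivity : 0 ≤ 2 * Real.pi) (abs_nonneg (j : ℝ))
    linarith
  have h1 : Summable fun j : ℤ => ‖a j‖ * |(j : ℝ)| := by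
    refine Summable.of_nonneg_of_le (fun _ => by positivity) (fun j => ?_)
      (ha.mul_left (2 * Real.pi)⁻¹)
    rw [inv_mul_eq_div, le_div_iff₀ (by positivity)]
    nlinarith [norm_nonneg (a j)]
  have hsplit : ∑' j : ℤ, ‖a j‖ * (1 + 2 * Real.pi * |(j : ℝ)|) =
      ∑' j, ‖a j‖ + 2 * Real.pi * ∑' j : ℤ, ‖a j‖ * |(j : ℝ)| := by
    rw [← tsum_mul_left, ← h0.tsum_add (h1.mul_left _)]
    exact tsum_congr fun j => by ring
  have hB : 0 ≤ ∑' j : ℤ, ‖a j‖ * |(j : ℝ)| := tsum_nonneg fun _ => by positivity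
  rw [hsplit]
  refine bvNorm_le_of_lipschitz (B := NNReal.mk _ hB) (fun x _ => ?_)
    (LipschitzWith.of_dist_le_mul fun x y => ?_).lipschitzOnWith
  · rw [← (hg x).tsum_eq]
    refine (norm_tsum_le_tsum_norm (by simpa [norm_fMode] using h0)).trans_eq ?_
    simp [norm_fMode]
  · rw [dist_eq_norm, Real.dist_eq, ← ((hg x).sub (hg y)).tsum_eq, NNReal.coe_mk, ← tsum_mul_right]
    refine tsum_of_norm_bounded (h1.mul_right _).hasSum fun j => ?_
    rw [← mul_sub, norm_mul, mul_assoc]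
    exact mul_le_mul_of_nonneg_left (dist_fMode_le j x y) (norm_nonneg _)

end Fourier

section TransferOperator

variable {β : ℕ} {v : ℝ → ℝ}

theorem contDiff_transferOp (hv : ContDiff ℝ 2 v) {φ : ℝ → ℂ} (hφ : ContDiff ℝ 1 φ) :
    ContDiff ℝ 1 (transferOp β v φ) := by
  have hv' : ContDiff ℝ 1 (deriv v) :=
    (contDiff_succ_iff_deriv.1 (hv : ContDiff ℝ (1 + 1) v)).2.2
  have hv1 : ContDiff ℝ 1 v := hv.of_le (by norm_num)
  refine ContDiff.sum fun b _ => ContDiff.mul ?_ ?_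
  · exact Complex.ofRealCLM.contDiff.comp (hv'.comp (contDiff_id.add contDiff_const))
  · exact hφ.comp (hv1.comp (contDiff_id.add contDiff_const))

theorem deriv_lift_add_period (hlift : ∀ x : ℝ, v (x + 2 * Real.pi * β) = v x + 2 * Real.pi)
    (x : ℝ) : deriv v (x + 2 * Real.pi * β) = deriv v x := by
  have h : (fun x => v (x + 2 * Real.pi * β)) = fun x => v x + 2 * Real.pi := funext hlift
  have h2 := congrFun (congrArg deriv h) x
  rwa [deriv_comp_add_const, deriv_add_const] at h2

theorem transferOp_add_period (hlift : ∀ x : ℝ, v (x + 2 * Real.pi * β) = v x + 2 * Real.pi)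
    {φ : ℝ → ℂ} (hper : ∀ x, φ (x + 2 * Real.pi) = φ x) (x : ℝ) :
    transferOp β v φ (x + 2 * Real.pi) = transferOp β v φ x := by
  let g : ℕ → ℂ := fun b =>
    ((deriv v (x + 2 * Real.pi * b) : ℝ) : ℂ) * φ (v (x + 2 * Real.pi * b))
  have h1 : transferOp β v φ (x + 2 * Real.pi) = ∑ b ∈ Finset.range β, g (b + 1) := by
    refine Finset.sum_congr rfl fun b _ => ?_
    simp only [g]
    rw [show x + 2 * Real.pi + 2 * Real.pi * b = x + 2 * Real.pi * ((b + 1 : ℕ) : ℝ) by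
      push_cast; ring]
  have h2 : g β = g 0 := by
    simp only [g]
    rw [deriv_lift_add_period hlift, hlift, hper]
    simp
  have h3 := Finset.sum_range_succ g β
  have h4 := Finset.sum_range_succ' g β
  rw [h1]
  change _ = ∑ b ∈ Finset.range β, g b
  rw [h3, h2] at h4
  exact (add_right_cancel h4).symm

theorem transferOp_sub_apply (φ ψ : ℝ → ℂ) (x : ℝ) :
    transferOp β v (fun x => φ x - ψ x) x = transferOp β v φ x - transferOp β v ψ x := by
  simp only [transferOp, mul_sub, Finset.sum_sub_distrib]

theorem transferOp_const_mul_apply (c : ℂ) (φ : ℝ → ℂ) (x : ℝ) :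
    transferOp β v (fun x => c * φ x) x = c * transferOp β v φ x := by
  simp only [transferOp, Finset.mul_sum, mul_left_comm]

theorem transferOp_sum {ι : Type*} (s : Finset ι) (c : ι → ℂ) (f : ι → ℝ → ℂ) :
    transferOp β v (fun x => ∑ i ∈ s, c i * f i x) =
      fun x => ∑ i ∈ s, c i * transferOp β v (f i) x := by
  funext x
  simp only [transferOp, Finset.mul_sum]
  rw [Finset.sum_comm]
  exact Finset.sum_congr rfl fun i _ => Finset.sum_congr rfl fun b _ => mul_left_comm _ _ _

theorem fCoeff_transferOp (hv : ContDiff ℝ 2 v) {φ : ℝ → ℂ} (hφ : Continuous φ) (j : ℤ) :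
    fCoeff (transferOp β v φ) j = (1 / (2 * Real.pi) : ℂ) *
      ∫ x in (0 : ℝ)..(2 * Real.pi * β), ((deriv v x : ℝ) : ℂ) * φ (v x) * fMode (-j) x := by
  have hv' : Continuous (deriv v) := hv.continuous_deriv (by norm_num)
  let g : ℝ → ℂ := fun x => ((deriv v x : ℝ) : ℂ) * φ (v x) * fMode (-j) x
  have hg : Continuous g := ((Complex.continuous_ofReal.comp hv').mul
    (hφ.comp hv.continuous)).mul (contDiff_fMode _).continuous
  have h1 : ∀ x : ℝ, transferOp β v φ x * fMode (-j) x =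
      ∑ b ∈ Finset.range β, g (x + 2 * Real.pi * b) := by
    intro x
    rw [transferOp, Finset.sum_mul]
    refine Finset.sum_congr rfl fun b _ => ?_
    have := fMode_add_period (-j) b x
    simp only [Int.cast_natCast] at this
    simp only [g, this]
  rw [fCoeff_eq]
  simp_rw [h1]
  have hint : ∀ b ∈ Finset.range β, IntervalIntegrable
      (fun x => g (x + 2 * Real.pi * b)) volume 0 (2 * Real.pi) := fun b _ =>
    (hg.comp (continuous_id.add continuous_const)).intervalIntegrable _ _
  rw [intervalIntegral.integral_finsetSum hint]
  simp_rw [intervalIntegral.integral_comp_add_right g]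
  have h2 := intervalIntegral.sum_integral_adjacent_intervals (f := g) (μ := volume)
    (a := fun n : ℕ => 2 * Real.pi * n) (n := β) fun k _ => hg.intervalIntegrable _ _
  simp only [Nat.cast_zero, mul_zero] at h2
  rw [← h2]
  congr 1
  refine Finset.sum_congr rfl fun b _ => ?_
  congr 1
  · ring
  · push_cast
    ring

theorem fCoeff_zero_transferOp (hv : ContDiff ℝ 2 v)
    (hlift : ∀ x : ℝ, v (x + 2 * Real.pi * β) = v x + 2 * Real.pi)
    {φ : ℝ → ℂ} (hφ : Continuous φ) (hper : ∀ x, φ (x + 2 * Real.pi) = φ x) :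
    fCoeff (transferOp β v φ) 0 = fCoeff φ 0 := by
  have hv' : Continuous (deriv v) := hv.continuous_deriv (by norm_num)
  have hf : ∀ x, fMode 0 x = 1 := fun x => by simp [fMode]
  rw [fCoeff_transferOp hv hφ, fCoeff_eq]
  congr 1
  simp only [neg_zero, hf, mul_one]
  have h := intervalIntegral.integral_deriv_smul_comp (a := 0) (b := 2 * Real.pi * β)
    (f := v) (f' := deriv v) (g := φ)
    (fun x _ => (hv.differentiable (by norm_num) x).hasDerivAt) hv'.continuousOn hφ
  have h0 := hlift 0
  rw [zero_add] at h0
  simp only [Function.comp, Complex.real_smul] at h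
  rw [h, h0, Function.Periodic.intervalIntegral_add_eq hper (v 0) 0, zero_add]

end TransferOperator

section Holomorphic

/-- Contour shift for a function holomorphic on a strip that is periodic along the real line. -/
theorem integral_eq_integral_shift {F : ℂ → ℂ} {δ T σ : ℝ}
    (hF : DifferentiableOn ℂ F {z : ℂ | |z.im| < δ}) (hσ : |σ| < δ)
    (hper : ∀ z : ℂ, |z.im| < δ → F (z + T) = F z) :
    ∫ x in (0 : ℝ)..T, F x = ∫ x in (0 : ℝ)..T, F (x + σ * Complex.I) := by
  have him : ∀ y ∈ Set.uIcc 0 σ, |y| < δ := fun y hy => by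
    have := Set.abs_sub_left_of_mem_uIcc hy
    simp only [sub_zero] at this
    exact this.trans_lt hσ
  have h := Complex.integral_boundary_rect_eq_zero_of_differentiableOn F 0 ⟨T, σ⟩
    (hF.mono fun z hz => him _ hz.2)
  have hv : ∫ y in (0 : ℝ)..σ, F (T + y * Complex.I) = ∫ y in (0 : ℝ)..σ, F (y * Complex.I) := by
    refine intervalIntegral.integral_congr fun y hy => ?_
    rw [add_comm, hper]
    simpa using him y hy
  simp only [Complex.zero_re, Complex.zero_im, Complex.ofReal_zero, zero_mul, add_zero, zero_add,
    hv, add_sub_cancel_right] at h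
  exact sub_eq_zero.1 h

variable {v : ℝ → ℝ} {V : ℂ → ℂ} {δ : ℝ}

theorem isOpen_strip (δ : ℝ) : IsOpen {z : ℂ | |z.im| < δ} :=
  isOpen_lt (continuous_abs.comp Complex.continuous_im) continuous_const

theorem convex_strip (δ : ℝ) : Convex ℝ {z : ℂ | |z.im| < δ} := by
  have : {z : ℂ | |z.im| < δ} = Complex.imCLM ⁻¹' (Set.Ioo (-δ) δ) := by
    ext z
    simp [abs_lt]
  rw [this]
  exact (convex_Ioo _ _).linear_preimage Complex.imLm

theorem ofReal_mem_strip (hδ : 0 < δ) (x : ℝ) : (x : ℂ) ∈ {z : ℂ | |z.im| < δ} := by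
  simpa using hδ

theorem contDiff_of_holomorphic (hδ : 0 < δ) (hVv : ∀ x : ℝ, V x = (v x : ℂ))
    (hV : DifferentiableOn ℂ V {z : ℂ | |z.im| < δ}) : ContDiff ℝ 2 v := by
  have h : v = fun x : ℝ => (V x).re := by
    funext x
    rw [hVv, Complex.ofReal_re]
  rw [h, contDiff_iff_contDiffAt]
  intro x
  have h1 : ContDiffAt ℂ 2 V (x : ℂ) :=
    ((hV.analyticOnNhd (isOpen_strip δ)) x (ofReal_mem_strip hδ x)).contDiffAt
  exact Complex.reCLM.contDiff.contDiffAt.comp x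
    ((h1.restrict_scalars ℝ).comp x Complex.ofRealCLM.contDiff.contDiffAt)

theorem deriv_ofReal_eq (hδ : 0 < δ) (hVv : ∀ x : ℝ, V x = (v x : ℂ))
    (hV : DifferentiableOn ℂ V {z : ℂ | |z.im| < δ}) (x : ℝ) :
    deriv V (x : ℂ) = (deriv v x : ℝ) := by
  have h1 : HasDerivAt (fun y : ℝ => V y) (deriv V x) x :=
    (hV.differentiableAt ((isOpen_strip δ).mem_nhds
      (ofReal_mem_strip hδ x))).hasDerivAt.comp_ofReal
  have h2 : HasDerivAt (fun y : ℝ => V y) ((deriv v x : ℝ) : ℂ) x := by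
    simp_rw [hVv]
    exact ((contDiff_of_holomorphic hδ hVv hV).differentiable (by norm_num) x).hasDerivAt.ofReal_comp
  exact h1.unique h2

theorem holomorphic_lift_add_period (hδ : 0 < δ) {T p : ℝ}
    (hlift : ∀ x : ℝ, v (x + T) = v x + p) (hVv : ∀ x : ℝ, V x = (v x : ℂ))
    (hV : DifferentiableOn ℂ V {z : ℂ | |z.im| < δ}) {z : ℂ} (hz : |z.im| < δ) :
    V (z + T) = V z + p := by
  have hshift : Set.MapsTo (fun z : ℂ => z + T) {z : ℂ | |z.im| < δ} {z : ℂ | |z.im| < δ} := by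
    intro z hz
    simpa using hz
  have h1 : AnalyticOnNhd ℂ (fun z => V (z + T)) {z : ℂ | |z.im| < δ} :=
    (hV.comp (differentiableOn_id.add_const (T : ℂ)) hshift).analyticOnNhd (isOpen_strip δ)
  have h2 : AnalyticOnNhd ℂ (fun z => V z + p) {z : ℂ | |z.im| < δ} :=
    (hV.add_const (p : ℂ)).analyticOnNhd (isOpen_strip δ)
  refine h1.eqOn_of_preconnected_of_frequently_eq h2 (convex_strip δ).isPreconnected
    (ofReal_mem_strip hδ 0) ?_ hz
  have h3 : Filter.Tendsto (fun x : ℝ => (x : ℂ)) (nhdsWithin 0 {0}ᶜ)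
      (nhdsWithin ((0 : ℝ) : ℂ) {((0 : ℝ) : ℂ)}ᶜ) := by
    refine Complex.continuous_ofReal.continuousWithinAt.tendsto_nhdsWithin fun x hx => ?_
    simpa using hx
  refine h3.frequently (Filter.Frequently.of_forall fun x => ?_)
  rw [← Complex.ofReal_add, hVv, hVv, hlift, Complex.ofReal_add]

theorem exists_norm_deriv_lt (hδ : 0 < δ) (T : ℝ) {κ : ℝ} (hκ : ∀ x : ℝ, ‖deriv V x‖ < κ)
    (hV : DifferentiableOn ℂ V {z : ℂ | |z.im| < δ}) :
    ∃ η > 0, η < δ ∧ ∀ x ∈ Set.Icc 0 T, ∀ t : ℝ, |t| ≤ η →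
      ‖deriv V (x + t * Complex.I)‖ < κ := by
  let U : Set ℂ := {z : ℂ | |z.im| < δ} ∩ (deriv V) ⁻¹' Metric.ball 0 κ
  have hU : IsOpen U :=
    (hV.deriv (isOpen_strip δ)).continuousOn.isOpen_inter_preimage (isOpen_strip δ)
      Metric.isOpen_ball
  have hK : IsCompact ((fun x : ℝ => (x : ℂ)) '' Set.Icc 0 T) :=
    isCompact_Icc.image Complex.continuous_ofReal
  have hKU : ((fun x : ℝ => (x : ℂ)) '' Set.Icc 0 T) ⊆ U := by
    rintro _ ⟨x, -, rfl⟩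
    exact ⟨ofReal_mem_strip hδ x, by simpa using hκ x⟩
  obtain ⟨ε, hε, hεU⟩ := hK.exists_cthickening_subset_open hU hKU
  refine ⟨min ε (δ / 2), by positivity, (min_le_right _ _).trans_lt (by linarith),
    fun x hx t ht => ?_⟩
  have hmem : (x + t * Complex.I : ℂ) ∈ U := by
    refine hεU (Metric.closedBall_subset_cthickening (Set.mem_image_of_mem _ hx) ε ?_)
    rw [Metric.mem_closedBall, dist_eq_norm, add_sub_cancel_left]
    simpa using ht.trans (min_le_left _ _)
  simpa using hmem.2

theorem abs_im_le_of_norm_deriv_lt (hVv : ∀ x : ℝ, V x = (v x : ℂ))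
    (hV : DifferentiableOn ℂ V {z : ℂ | |z.im| < δ}) {κ η x t : ℝ} (hη : η < δ)
    (hκ : ∀ t : ℝ, |t| ≤ η → ‖deriv V (x + t * Complex.I)‖ < κ) (ht : |t| ≤ η) :
    |(V (x + t * Complex.I)).im| ≤ κ * |t| := by
  let S : Set ℝ := Set.Icc (-η) η
  have hd : ∀ s ∈ S, HasDerivWithinAt (fun s : ℝ => V (x + s * Complex.I))
      (deriv V (x + s * Complex.I) * Complex.I) S s := by
    intro s hs
    have hmem : (x + s * Complex.I : ℂ) ∈ {z : ℂ | |z.im| < δ} := by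
      simpa using (abs_le.2 hs).trans_lt hη
    have h1 := (hV.differentiableAt ((isOpen_strip δ).mem_nhds hmem)).hasDerivAt
    have h2 : HasDerivAt (fun s : ℂ => x + s * Complex.I) Complex.I (s : ℂ) := by
      simpa using ((hasDerivAt_id (s : ℂ)).mul_const Complex.I).const_add (x : ℂ)
    exact ((h1.comp (s : ℂ) h2).comp_ofReal).hasDerivWithinAt
  have h := (convex_Icc (-η) η).norm_image_sub_le_of_norm_hasDerivWithin_le hd
    (C := κ) (fun s hs => by simpa using (hκ s (abs_le.2 hs)).le)
    (x := 0) (y := t) ⟨by linarith [abs_nonneg t], by linarith [abs_nonneg t]⟩ (abs_le.1 ht)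
  simp only [Complex.ofReal_zero, zero_mul, add_zero, sub_zero, hVv, Real.norm_eq_abs] at h
  refine le_trans ?_ h
  have h3 := Complex.abs_im_le_norm (V (x + t * Complex.I) - (v x : ℂ))
  simpa using h3

/-- Exponential decay of the matrix entries of the transfer operator in the Fourier basis. -/
theorem exists_norm_fCoeff_transferOp_fMode_le {β : ℕ} {q : ℝ} (hδ : 0 < δ) (hq : q < 1)
    (hlift : ∀ x : ℝ, v (x + 2 * Real.pi * β) = v x + 2 * Real.pi)
    (hd : ∀ x : ℝ, 0 < deriv v x ∧ deriv v x ≤ q) (hVv : ∀ x : ℝ, V x = (v x : ℂ))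
    (hV : DifferentiableOn ℂ V {z : ℂ | |z.im| < δ}) :
    ∃ η > 0, ∃ α ≥ 0, ∃ C ≥ 0, η < δ ∧ α < η ∧ ∀ j k : ℤ,
      ‖fCoeff (transferOp β v (fMode k)) j‖ ≤
        C * Real.exp (-η * |(j : ℝ)|) * Real.exp (α * |(k : ℝ)|) := by
  have hq0 : 0 < q := (hd 0).1.trans_le (hd 0).2
  have hvC := contDiff_of_holomorphic hδ hVv hV
  set κ : ℝ := (q + 1) / 2 with hκ
  have hκ0 : 0 < κ := by positivity
  have hκ1 : κ < 1 := by linarith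
  set T : ℝ := 2 * Real.pi * β with hT
  have hT0 : 0 ≤ T := by positivity
  have hqκ : ∀ x : ℝ, ‖deriv V x‖ < κ := fun x => by
    rw [deriv_ofReal_eq hδ hVv hV, Complex.norm_real, Real.norm_eq_abs, abs_of_pos (hd x).1]
    linarith [(hd x).2]
  obtain ⟨η, hη, hηδ, hbd⟩ := exists_norm_deriv_lt hδ T hqκ hV
  have hVper : ∀ z : ℂ, |z.im| < δ → V (z + T) = V z + (2 * Real.pi : ℝ) :=
    fun z hz => holomorphic_lift_add_period hδ hlift hVv hV hz
  have hV'per : ∀ z : ℂ, |z.im| < δ → deriv V (z + T) = deriv V z := by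
    intro z hz
    have h : (fun w => V (w + T)) =ᶠ[nhds z] fun w => V w + (2 * Real.pi : ℝ) :=
      Filter.eventually_of_mem ((isOpen_strip δ).mem_nhds hz) hVper
    rw [← deriv_comp_add_const, h.deriv_eq, deriv_add_const]
  refine ⟨η, hη, κ * η, by positivity, 1 / (2 * Real.pi) * (κ * T), by positivity, hηδ,
    mul_lt_of_lt_one_left hη hκ1, fun j k => ?_⟩
  let F : ℂ → ℂ := fun z => deriv V z * Complex.exp (Complex.I * k * V z) *
    Complex.exp (Complex.I * ((-j : ℤ) : ℂ) * z)
  have hF : DifferentiableOn ℂ F {z : ℂ | |z.im| < δ} :=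
    ((hV.deriv (isOpen_strip δ)).mul (hV.const_mul _).cexp).mul
      (differentiableOn_id.const_mul _).cexp
  have hFper : ∀ z : ℂ, |z.im| < δ → F (z + T) = F z := by
    intro z hz
    have e1 : Complex.exp (Complex.I * k * (V z + (2 * Real.pi : ℝ))) =
        Complex.exp (Complex.I * k * V z) :=
      Complex.exp_eq_exp_iff_exists_int.2 ⟨k, by push_cast; ring⟩
    have e2 : Complex.exp (Complex.I * ((-j : ℤ) : ℂ) * (z + T)) =
        Complex.exp (Complex.I * ((-j : ℤ) : ℂ) * z) :=
      Complex.exp_eq_exp_iff_exists_int.2 ⟨-j * β, by rw [hT]; push_cast; ring⟩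
    simp only [F, hV'per z hz, hVper z hz, e1, e2]
  obtain ⟨σ, hσ, hjσ⟩ : ∃ σ : ℝ, |σ| = η ∧ j * σ = -η * |(j : ℝ)| := by
    rcases le_total 0 (j : ℝ) with h | h
    · exact ⟨-η, by rw [abs_neg, abs_of_pos hη], by rw [abs_of_nonneg h]; ring⟩
    · exact ⟨η, abs_of_pos hη, by rw [abs_of_nonpos h]; ring⟩
  have hshift := integral_eq_integral_shift hF (hσ.trans_lt hηδ) hFper
  have hFreal : ∀ x : ℝ, ((deriv v x : ℝ) : ℂ) * fMode k (v x) * fMode (-j) x = F x := by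
    intro x
    simp only [F, fMode, deriv_ofReal_eq hδ hVv hV, hVv]
  rw [fCoeff_transferOp hvC (contDiff_fMode k).continuous, ← hT]
  simp_rw [hFreal]
  rw [hshift, norm_mul]
  have h1 : ‖(1 / (2 * Real.pi) : ℂ)‖ = 1 / (2 * Real.pi) := by
    simp [abs_of_pos Real.pi_pos]
  have h2 : ‖∫ x in (0 : ℝ)..T, F (x + σ * Complex.I)‖ ≤
      κ * Real.exp (κ * η * |(k : ℝ)|) * Real.exp (-η * |(j : ℝ)|) * |T - 0| := by
    refine intervalIntegral.norm_integral_le_of_norm_le_const fun x hx => ?_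
    rw [Set.uIoc_of_le hT0] at hx
    have hxI : x ∈ Set.Icc 0 T := ⟨hx.1.le, hx.2⟩
    have him := abs_im_le_of_norm_deriv_lt hVv hV hηδ (hbd x hxI) hσ.le
    rw [hσ] at him
    simp only [F, norm_mul, Complex.norm_exp]
    refine mul_le_mul (mul_le_mul (hbd x hxI σ hσ.le).le (Real.exp_le_exp.2 ?_) (by positivity)
      hκ0.le) (Real.exp_le_exp.2 ?_) (by positivity) (by positivity)
    · have : (Complex.I * k * V (x + σ * Complex.I)).re = -(k * (V (x + σ * Complex.I)).im) := by
        simp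
      rw [this]
      refine (neg_le_abs _).trans ?_
      rw [abs_mul, mul_comm]
      exact mul_le_mul_of_nonneg_right him (abs_nonneg _)
    · have : (Complex.I * ((-j : ℤ) : ℂ) * (x + σ * Complex.I)).re = j * σ := by
        simp
      rw [this, hjσ]
  rw [sub_zero, abs_of_nonneg hT0] at h2
  rw [h1]
  calc _ ≤ 1 / (2 * Real.pi) *
        (κ * Real.exp (κ * η * |(k : ℝ)|) * Real.exp (-η * |(j : ℝ)|) * T) := by gcongr
    _ = _ := by ring

end Holomorphic

section Summability

theorem summable_poly_mul_exp_neg_abs {r : ℝ} (hr : 0 < r) :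
    Summable fun j : ℤ => (1 + 2 * Real.pi * |(j : ℝ)|) * Real.exp (-r * |(j : ℝ)|) := by
  have h : Summable fun n : ℕ => (1 + 2 * Real.pi * (n : ℝ)) * Real.exp (-r * n) := by
    refine ((Real.summable_pow_mul_exp_neg_nat_mul 0 hr).add
      ((Real.summable_pow_mul_exp_neg_nat_mul 1 hr).mul_left (2 * Real.pi))).congr fun n => ?_
    ring
  refine Summable.of_nat_of_neg ?_ ?_ <;> simpa using h

theorem summable_exp_neg_abs {r : ℝ} (hr : 0 < r) :
    Summable fun j : ℤ => Real.exp (-r * |(j : ℝ)|) := by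
  refine Summable.of_nonneg_of_le (fun _ => by positivity) (fun j => ?_)
    (summable_poly_mul_exp_neg_abs hr)
  refine le_mul_of_one_le_left (by positivity) ?_
  have := mul_nonneg (by positivity : 0 ≤ 2 * Real.pi) (abs_nonneg (j : ℝ))
  linarith

end Summability

section SpectralGap

variable {β : ℕ} {v : ℝ → ℝ}

theorem contDiff_iterate_transferOp (hv : ContDiff ℝ 2 v) {φ : ℝ → ℂ} (hφ : ContDiff ℝ 1 φ)
    (n : ℕ) : ContDiff ℝ 1 ((transferOp β v)^[n] φ) := by
  induction n with
  | zero => exact hφ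
  | succ n ih =>
    rw [Function.iterate_succ_apply']
    exact contDiff_transferOp hv ih

/-- Under the spectral gap, `I - L` is boundedly invertible in BV on mean-zero functions. -/
theorem bvNorm_sub_mul_density_le (hv : ContDiff ℝ 2 v)
    (hlift : ∀ x : ℝ, v (x + 2 * Real.pi * β) = v x + 2 * Real.pi)
    {C₀ θ : ℝ} (hC₀ : 0 < C₀) (hθ0 : 0 < θ) (hθ1 : θ < 1)
    (hgap : ∀ ψ : ℝ → ℂ, (∀ x : ℝ, ψ (x + 2 * Real.pi) = ψ x) →
      BoundedVariationOn ψ J → (∫ x in (0 : ℝ)..(2 * Real.pi), ψ x) = 0 →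
      ∀ n : ℕ, bvNorm ((transferOp β v)^[n] ψ) ≤ C₀ * θ ^ n * bvNorm ψ)
    {ρ : ℝ → ℂ} (hρper : ∀ x : ℝ, ρ (x + 2 * Real.pi) = ρ x) (hρbv : BoundedVariationOn ρ J)
    (hρfix : ∀ x : ℝ, transferOp β v ρ x = ρ x)
    (hρint : (∫ x in (0 : ℝ)..(2 * Real.pi), ρ x) = 1)
    {u : ℝ → ℂ} (hu : ContDiff ℝ 1 u) (huper : ∀ x, u (x + 2 * Real.pi) = u x) {s : ℂ}
    (hs : (∫ x in (0 : ℝ)..(2 * Real.pi), u x) = s) :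
    bvNorm (fun x => u x - s * ρ x) ≤
      C₀ / (1 - θ) * bvNorm (fun x => u x - transferOp β v u x) := by
  set w : ℝ → ℂ := fun x => u x - s * ρ x with hw
  set g : ℝ → ℂ := fun x => u x - transferOp β v u x with hg
  have hρi : IntervalIntegrable ρ volume 0 (2 * Real.pi) := by
    by_contra h
    rw [intervalIntegral.integral_undef h] at hρint
    exact zero_ne_one hρint
  have hLu : ContDiff ℝ 1 (transferOp β v u) := contDiff_transferOp hv hu
  have hgC : ContDiff ℝ 1 g := hu.sub hLu
  have hgap_g := hgap g (fun x => by simp only [hg, transferOp_add_period hlift huper, huper])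
    hgC.boundedVariationOn_period (by
      rw [hg, intervalIntegral.integral_sub (hu.continuous.intervalIntegrable _ _)
        (hLu.continuous.intervalIntegrable _ _), integral_eq_fCoeff_zero, integral_eq_fCoeff_zero,
        fCoeff_zero_transferOp hv hlift hu.continuous huper, sub_self])
  have hsρ : BoundedVariationOn (fun x => -s * ρ x) J := hρbv.const_mul (-s)
  have hbv : ∀ φ : ℝ → ℂ, ContDiff ℝ 1 φ → BoundedVariationOn (fun x => φ x - s * ρ x) J := by
    intro φ hφ
    have := hφ.boundedVariationOn_period.fun_add hsρ
    simpa [sub_eq_add_neg] using this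
  have hgap_w := hgap w (fun x => by simp only [hw, huper, hρper]) (hbv u hu) (by
      rw [hw, intervalIntegral.integral_sub (hu.continuous.intervalIntegrable _ _)
        (hρi.const_mul s), intervalIntegral.integral_const_mul, hs, hρint, mul_one, sub_self])
  have hLw : ∀ n, (transferOp β v)^[n] w = fun x => (transferOp β v)^[n] u x - s * ρ x := by
    intro n
    induction n with
    | zero => rfl
    | succ n ih =>
      rw [Function.iterate_succ_apply', ih]
      funext x
      rw [transferOp_sub_apply, transferOp_const_mul_apply, hρfix, Function.iterate_succ_apply']
  have hLg : ∀ n, (transferOp β v)^[n] g =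
      fun x => (transferOp β v)^[n] u x - (transferOp β v)^[n + 1] u x := by
    intro n
    induction n with
    | zero => rfl
    | succ n ih =>
      rw [Function.iterate_succ_apply', ih]
      funext x
      rw [transferOp_sub_apply, ← Function.iterate_succ_apply' (transferOp β v) n,
        ← Function.iterate_succ_apply' (transferOp β v) (n + 1)]
  have hLuC := contDiff_iterate_transferOp (β := β) hv hu
  have hS : ∀ n, bvNorm (fun x => u x - (transferOp β v)^[n] u x) ≤
      C₀ * (∑ i ∈ Finset.range n, θ ^ i) * bvNorm g := by
    intro n
    induction n with
    | zero => simp [bvNorm_zero]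
    | succ n ih =>
      have h1 := bvNorm_add_le (hu.sub (hLuC n)).boundedVariationOn_period
        ((hLuC n).sub (hLuC (n + 1))).boundedVariationOn_period
      have h2 := hgap_g n
      rw [hLg] at h2
      simp only [sub_add_sub_cancel] at h1
      rw [Finset.sum_range_succ]
      linarith
  have hn : ∀ n, bvNorm w ≤ C₀ * θ ^ n * bvNorm w + C₀ / (1 - θ) * bvNorm g := by
    intro n
    have h1 := bvNorm_add_le (hbv _ (hLuC n)) (hu.sub (hLuC n)).boundedVariationOn_period
    have h2 := hgap_w n
    rw [hLw] at h2
    have h3 : (fun x => (transferOp β v)^[n] u x - s * ρ x + (u x - (transferOp β v)^[n] u x)) =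
        w := by
      funext x
      simp only [hw]
      ring
    rw [h3] at h1
    have h4 : ∑ i ∈ Finset.range n, θ ^ i ≤ (1 - θ)⁻¹ := by
      rw [← tsum_geometric_of_lt_one hθ0.le hθ1]
      exact (summable_geometric_of_lt_one hθ0.le hθ1).sum_le_tsum _ fun i _ => by positivity
    have h5 : C₀ * (∑ i ∈ Finset.range n, θ ^ i) * bvNorm g ≤ C₀ / (1 - θ) * bvNorm g := by
      rw [div_eq_mul_inv]
      exact mul_le_mul_of_nonneg_right (mul_le_mul_of_nonneg_left h4 hC₀.le) (bvNorm_nonneg g)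
    linarith [hS n]
  have hlim : Filter.Tendsto (fun n : ℕ => C₀ * θ ^ n * bvNorm w + C₀ / (1 - θ) * bvNorm g)
      Filter.atTop (nhds (C₀ * 0 * bvNorm w + C₀ / (1 - θ) * bvNorm g)) :=
    (((tendsto_pow_atTop_nhds_zero_of_lt_one hθ0.le hθ1).const_mul C₀).mul_const _).add_const _
  have := ge_of_tendsto' hlim hn
  simpa using this

end SpectralGap

section Galerkin

variable {β : ℕ} {v : ℝ → ℝ}

theorem trigPoly_add_period (N : ℕ) (c : ℤ → ℂ) (x : ℝ) :
    trigPoly N c (x + 2 * Real.pi) = trigPoly N c x := by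
  refine Finset.sum_congr rfl fun j _ => ?_
  have := fMode_add_period j 1 x
  rw [Int.cast_one, mul_one] at this
  rw [this]

theorem fCoeff_transferOp_trigPoly (hv : ContDiff ℝ 2 v) (N : ℕ) (c : ℤ → ℂ) (j : ℤ) :
    fCoeff (transferOp β v (trigPoly N c)) j =
      ∑ k ∈ Finset.Icc (-(N : ℤ)) (N : ℤ), c k * fCoeff (transferOp β v (fMode k)) j := by
  have h : transferOp β v (trigPoly N c) = fun x => ∑ k ∈ Finset.Icc (-(N : ℤ)) (N : ℤ),
      c k * transferOp β v (fMode k) x := transferOp_sum _ _ _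
  rw [h, fCoeff_sum _ _ _ fun k _ => (contDiff_transferOp hv (contDiff_fMode k)).continuous]

/-- The weighted `ℓ¹` norm of the coefficients of a trigonometric polynomial. -/
noncomputable def weightNorm (α : ℝ) (N : ℕ) (c : ℤ → ℂ) : ℝ :=
  ∑ k ∈ Finset.Icc (-(N : ℤ)) (N : ℤ), ‖c k‖ * Real.exp (α * |(k : ℝ)|)

theorem weightNorm_nonneg (α : ℝ) (N : ℕ) (c : ℤ → ℂ) : 0 ≤ weightNorm α N c :=
  Finset.sum_nonneg fun _ _ => by positivity

/-- The transfer operator improves analyticity: its matrix maps weight `α` to weight `η`. -/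
def MatrixDecay (β : ℕ) (v : ℝ → ℝ) (η α C : ℝ) : Prop :=
  ∀ j k : ℤ, ‖fCoeff (transferOp β v (fMode k)) j‖ ≤
    C * Real.exp (-η * |(j : ℝ)|) * Real.exp (α * |(k : ℝ)|)

theorem MatrixDecay.norm_fCoeff_le {η α C : ℝ} (h : MatrixDecay β v η α C)
    (hv : ContDiff ℝ 2 v) (N : ℕ) (c : ℤ → ℂ) (j : ℤ) :
    ‖fCoeff (transferOp β v (trigPoly N c)) j‖ ≤
      C * Real.exp (-η * |(j : ℝ)|) * weightNorm α N c := by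
  rw [fCoeff_transferOp_trigPoly hv, weightNorm, Finset.mul_sum]
  refine (norm_sum_le _ _).trans (Finset.sum_le_sum fun k _ => ?_)
  rw [norm_mul]
  calc _ ≤ ‖c k‖ * (C * Real.exp (-η * |(j : ℝ)|) * Real.exp (α * |(k : ℝ)|)) :=
        mul_le_mul_of_nonneg_left (h j k) (norm_nonneg _)
    _ = _ := by ring

/-- A fixed point of the truncated transfer operator is controlled in the weighted norm by its
BV norm, uniformly in the truncation degree. -/
theorem MatrixDecay.exists_weightNorm_le {η α C : ℝ} (h : MatrixDecay β v η α C)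
    (hv : ContDiff ℝ 2 v) (hα : α < η) :
    ∃ D ≥ 0, ∀ (N : ℕ) (c : ℤ → ℂ),
      (∀ j ∈ Finset.Icc (-(N : ℤ)) (N : ℤ),
        c j = fCoeff (transferOp β v (trigPoly N c)) j) →
      weightNorm α N c ≤ D * bvNorm (trigPoly N c) := by
  have hsum : Summable fun j : ℤ => C * Real.exp (-(η - α) * |(j : ℝ)|) :=
    (summable_exp_neg_abs (sub_pos.2 hα)).mul_left C
  obtain ⟨s, hs⟩ := summable_iff_vanishing_norm.1 hsum (1 / 2) (by norm_num)
  refine ⟨2 * ∑ k ∈ s, Real.exp (α * |(k : ℝ)|), by positivity, fun N c hc => ?_⟩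
  set I := Finset.Icc (-(N : ℤ)) (N : ℤ) with hI
  have hW := weightNorm_nonneg α N c
  have hB := bvNorm_nonneg (trigPoly N c)
  have hlow : ∑ k ∈ I ∩ s, ‖c k‖ * Real.exp (α * |(k : ℝ)|) ≤
      (∑ k ∈ s, Real.exp (α * |(k : ℝ)|)) * bvNorm (trigPoly N c) := by
    rw [Finset.sum_mul]
    refine (Finset.sum_le_sum fun k hk => ?_).trans
      (Finset.sum_le_sum_of_subset_of_nonneg Finset.inter_subset_right fun k _ _ =>
        mul_nonneg (Real.exp_pos _).le hB)
    have h1 := norm_fCoeff_le_bvNorm (contDiff_trigPoly N c).boundedVariationOn_period k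
    rw [fCoeff_trigPoly, if_pos (Finset.inter_subset_left hk)] at h1
    rw [mul_comm]
    exact mul_le_mul_of_nonneg_left h1 (Real.exp_pos _).le
  have hhigh : ∑ k ∈ I \ s, ‖c k‖ * Real.exp (α * |(k : ℝ)|) ≤ 1 / 2 * weightNorm α N c := by
    have h1 : ∑ k ∈ I \ s, ‖c k‖ * Real.exp (α * |(k : ℝ)|) ≤
        (∑ k ∈ I \ s, C * Real.exp (-(η - α) * |(k : ℝ)|)) * weightNorm α N c := by
      rw [Finset.sum_mul]
      refine Finset.sum_le_sum fun k hk => ?_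
      have h2 := h.norm_fCoeff_le hv N c k
      rw [← hc k (Finset.sdiff_subset hk)] at h2
      refine (mul_le_mul_of_nonneg_right h2 (Real.exp_pos _).le).trans_eq ?_
      rw [show -(η - α) * |(k : ℝ)| = -η * |(k : ℝ)| + α * |(k : ℝ)| by ring, Real.exp_add]
      ring
    have h3 := hs (I \ s) Finset.sdiff_disjoint
    exact h1.trans (mul_le_mul_of_nonneg_right ((le_abs_self _).trans h3.le) hW)
  have hsplit : weightNorm α N c = ∑ k ∈ I ∩ s, ‖c k‖ * Real.exp (α * |(k : ℝ)|) +
      ∑ k ∈ I \ s, ‖c k‖ * Real.exp (α * |(k : ℝ)|) := by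
    rw [weightNorm, ← hI, Finset.sum_inter_add_sum_sdiff]
  linarith

/-- Exponential smallness of the truncation error of the transfer operator. -/
theorem MatrixDecay.exists_bvNorm_fTrunc_sub_le {η α C : ℝ} (h : MatrixDecay β v η α C)
    (hv : ContDiff ℝ 2 v) (hlift : ∀ x : ℝ, v (x + 2 * Real.pi * β) = v x + 2 * Real.pi)
    (hC : 0 ≤ C) (hη : 0 < η) :
    ∃ E ≥ 0, ∀ (N : ℕ) (c : ℤ → ℂ),
      bvNorm (fun x => fTrunc N (transferOp β v (trigPoly N c)) x -
        transferOp β v (trigPoly N c) x) ≤ E * Real.exp (-(η / 2) * N) * weightNorm α N c := by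
  have hS := summable_poly_mul_exp_neg_abs (half_pos hη)
  set S := ∑' j : ℤ, (1 + 2 * Real.pi * |(j : ℝ)|) * Real.exp (-(η / 2) * |(j : ℝ)|) with hSdef
  refine ⟨C * S, mul_nonneg hC (tsum_nonneg fun _ => by positivity), fun N c => ?_⟩
  have hW := weightNorm_nonneg α N c
  set g := transferOp β v (trigPoly N c) with hg
  have hgC : ContDiff ℝ 1 g := contDiff_transferOp hv (contDiff_trigPoly N c)
  have hgper : ∀ x, g (x + 2 * Real.pi) = g x :=
    transferOp_add_period hlift (trigPoly_add_period N c)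
  have hco := h.norm_fCoeff_le hv N c
  rw [← hg] at hco
  have hsum : Summable (fCoeff g) := by
    refine Summable.of_norm_bounded (((summable_exp_neg_abs hη).mul_left C).mul_right _) hco
  set I := Finset.Icc (-(N : ℤ)) (N : ℤ) with hI
  let a : ℤ → ℂ := fun j => if j ∈ I then 0 else -fCoeff g j
  have ha : ∀ x, HasSum (fun j => a j * fMode j x) (fTrunc N g x - g x) := by
    intro x
    have h1 : HasSum (fun j => if j ∈ I then fCoeff g j * fMode j x else 0) (fTrunc N g x) := by
      have h2 : fTrunc N g x = ∑ j ∈ I, if j ∈ I then fCoeff g j * fMode j x else 0 := by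
        rw [fTrunc_eq_trigPoly, trigPoly]
        exact Finset.sum_congr rfl fun j hj => (if_pos hj).symm
      rw [h2]
      exact hasSum_sum_of_ne_finset_zero fun j hj => if_neg hj
    refine (h1.sub (hasSum_fCoeff_mul_fMode hgC.continuous hgper hsum x)).congr_fun fun j => ?_
    by_cases hj : j ∈ I <;> simp [a, hj]
  have hbd : ∀ j : ℤ, ‖a j‖ * (1 + 2 * Real.pi * |(j : ℝ)|) ≤
      C * Real.exp (-(η / 2) * N) * weightNorm α N c *
        ((1 + 2 * Real.pi * |(j : ℝ)|) * Real.exp (-(η / 2) * |(j : ℝ)|)) := by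
    intro j
    by_cases hj : j ∈ I
    · simp only [a, if_pos hj, norm_zero, zero_mul]
      positivity
    · have hNj : (N : ℝ) ≤ |(j : ℝ)| := by
        rw [hI, Finset.mem_Icc, ← abs_le, not_le] at hj
        exact_mod_cast hj.le
      simp only [a, if_neg hj, norm_neg]
      calc _ ≤ C * Real.exp (-η * |(j : ℝ)|) * weightNorm α N c *
            (1 + 2 * Real.pi * |(j : ℝ)|) := by gcongr; exact hco j
        _ ≤ C * (Real.exp (-(η / 2) * N) * Real.exp (-(η / 2) * |(j : ℝ)|)) *
            weightNorm α N c * (1 + 2 * Real.pi * |(j : ℝ)|) := by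
          gcongr
          rw [← Real.exp_add]
          exact Real.exp_le_exp.2 (by nlinarith)
        _ = _ := by ring
  have hsum2 := hS.mul_left (C * Real.exp (-(η / 2) * N) * weightNorm α N c)
  have hsum1 := Summable.of_nonneg_of_le (fun _ => by positivity) hbd hsum2
  calc _ ≤ _ := bvNorm_le_tsum hsum1 ha
    _ ≤ _ := hsum1.tsum_le_tsum hbd hsum2
    _ = C * S * Real.exp (-(η / 2) * N) * weightNorm α N c := by
      rw [tsum_mul_left, ← hSdef]
      ring

/-- The residual coefficients of the Galerkin equation with right-hand side `s / 2π`. -/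
noncomputable def galerkinResidual (β : ℕ) (v : ℝ → ℝ) (N : ℕ) (s : ℂ) (c : ℤ → ℂ) (j : ℤ) : ℂ :=
  c j - ∑ k ∈ Finset.Icc (-(N : ℤ)) (N : ℤ), c k * fCoeff (transferOp β v (fMode k)) j +
    if j = 0 then c 0 - s * (1 / (2 * Real.pi)) else 0

theorem zero_mem_Icc_neg (N : ℕ) : (0 : ℤ) ∈ Finset.Icc (-(N : ℤ)) (N : ℤ) := by
  simp

theorem galerkin_equation_iff (hv : ContDiff ℝ 2 v) (N : ℕ) (c : ℤ → ℂ) :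
    (∀ x : ℝ, trigPoly N c x - fTrunc N (transferOp β v (trigPoly N c)) x +
      (1 / (2 * Real.pi) : ℂ) * (∫ t in (0 : ℝ)..(2 * Real.pi), trigPoly N c t) =
        (1 / (2 * Real.pi) : ℂ)) ↔
    ∀ j ∈ Finset.Icc (-(N : ℤ)) (N : ℤ), galerkinResidual β v N 1 c j = 0 := by
  have hpi : (Real.pi : ℂ) ≠ 0 := by exact_mod_cast Real.pi_ne_zero
  have h0 := zero_mem_Icc_neg N
  have hint : (1 / (2 * Real.pi) : ℂ) * (∫ t in (0 : ℝ)..(2 * Real.pi), trigPoly N c t) = c 0 := by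
    rw [integral_eq_fCoeff_zero, fCoeff_trigPoly, if_pos h0]
    field_simp
  have hres : ∀ x, trigPoly N (galerkinResidual β v N 1 c) x =
      trigPoly N c x - fTrunc N (transferOp β v (trigPoly N c)) x + c 0 -
        (1 / (2 * Real.pi) : ℂ) := by
    intro x
    rw [fTrunc_eq_trigPoly]
    unfold trigPoly
    simp only [galerkinResidual, add_mul, sub_mul, Finset.sum_add_distrib,
      Finset.sum_sub_distrib, ite_mul, zero_mul, one_mul]
    rw [Finset.sum_ite_eq' _ _ _, if_pos h0]
    have hm : fMode 0 x = 1 := by simp [fMode]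
    have hA := fun j => fCoeff_transferOp_trigPoly (β := β) hv N c j
    unfold trigPoly at hA
    simp_rw [hA, hm]
    ring
  rw [hint]
  constructor
  · intro h j hj
    have hz : trigPoly N (galerkinResidual β v N 1 c) = trigPoly N 0 := by
      funext x
      rw [hres, h x, sub_self]
      simp [trigPoly]
    have := congrArg (fun f => fCoeff f j) hz
    simpa only [fCoeff_trigPoly, if_pos hj, Pi.zero_apply] using this
  · intro h x
    rw [← sub_eq_zero, ← hres]
    exact Finset.sum_eq_zero fun j hj => by rw [h j hj, zero_mul]

theorem galerkinResidual_sub (N : ℕ) (s t : ℂ) (c d : ℤ → ℂ) (j : ℤ) :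
    galerkinResidual β v N (s - t) (c - d) j =
      galerkinResidual β v N s c j - galerkinResidual β v N t d j := by
  simp only [galerkinResidual, Pi.sub_apply, sub_mul, Finset.sum_sub_distrib]
  split_ifs <;> ring

theorem coeff_eq_of_galerkinResidual_eq_zero (hv : ContDiff ℝ 2 v)
    (hlift : ∀ x : ℝ, v (x + 2 * Real.pi * β) = v x + 2 * Real.pi) {N : ℕ} {s : ℂ} {c : ℤ → ℂ}
    (hc : ∀ j ∈ Finset.Icc (-(N : ℤ)) (N : ℤ), galerkinResidual β v N s c j = 0) :
    (∫ x in (0 : ℝ)..(2 * Real.pi), trigPoly N c x) = s ∧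
      ∀ j ∈ Finset.Icc (-(N : ℤ)) (N : ℤ),
        c j = fCoeff (transferOp β v (trigPoly N c)) j := by
  have hpi : (Real.pi : ℂ) ≠ 0 := by exact_mod_cast Real.pi_ne_zero
  have h0 := zero_mem_Icc_neg N
  have hL0 : fCoeff (transferOp β v (trigPoly N c)) 0 = c 0 := by
    rw [fCoeff_zero_transferOp hv hlift (contDiff_trigPoly N c).continuous
      (trigPoly_add_period N c), fCoeff_trigPoly, if_pos h0]
  have hres : ∀ j ∈ Finset.Icc (-(N : ℤ)) (N : ℤ),
      c j - fCoeff (transferOp β v (trigPoly N c)) j +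
        (if j = 0 then c 0 - s * (1 / (2 * Real.pi)) else 0) = 0 := fun j hj => by
    rw [fCoeff_transferOp_trigPoly hv]
    exact hc j hj
  have hc0 := hres 0 h0
  rw [hL0, sub_self, zero_add, if_pos rfl] at hc0
  refine ⟨?_, fun j hj => ?_⟩
  · rw [integral_eq_fCoeff_zero, fCoeff_trigPoly, if_pos h0, sub_eq_zero.1 hc0]
    field_simp
  · have h1 := hres j hj
    rw [hc0, ite_self, add_zero] at h1
    exact sub_eq_zero.1 h1

theorem exists_galerkinResidual_eq_zero {N : ℕ}
    (hinj : ∀ c : ℤ → ℂ, (∀ j ∈ Finset.Icc (-(N : ℤ)) (N : ℤ),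
      galerkinResidual β v N 0 c j = 0) → ∀ j ∈ Finset.Icc (-(N : ℤ)) (N : ℤ), c j = 0) (s : ℂ) :
    ∃ c : ℤ → ℂ, ∀ j ∈ Finset.Icc (-(N : ℤ)) (N : ℤ), galerkinResidual β v N s c j = 0 := by
  set I := Finset.Icc (-(N : ℤ)) (N : ℤ) with hI
  let ext : (I → ℂ) → ℤ → ℂ := fun c j => if hj : j ∈ I then c ⟨j, hj⟩ else 0
  have hext : ∀ (c : I → ℂ) (j : I), ext c j = c j := fun c j => dif_pos j.2
  have hadd : ∀ c d, ext (c + d) = ext c + ext d := by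
    intro c d
    funext j
    by_cases hj : j ∈ I <;> simp [ext, hj]
  have hsmul : ∀ (a : ℂ) c, ext (a • c) = a • ext c := by
    intro a c
    funext j
    by_cases hj : j ∈ I <;> simp [ext, hj]
  let T : (I → ℂ) →ₗ[ℂ] (I → ℂ) :=
    { toFun := fun c j => galerkinResidual β v N 0 (ext c) j
      map_add' := fun c d => by
        funext j
        simp only [hadd, galerkinResidual, Pi.add_apply, add_mul, Finset.sum_add_distrib]
        split_ifs <;> ring
      map_smul' := fun a c => by
        funext j
        simp only [hsmul, galerkinResidual, Pi.smul_apply, smul_eq_mul, RingHom.id_apply,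
          mul_assoc, ← Finset.mul_sum]
        split_ifs <;> ring }
  have hT : Function.Injective T :=
    (injective_iff_map_eq_zero T).2 fun c hc => funext fun j =>
      (hext c j).symm.trans (hinj (ext c) (fun j hj => congrFun hc ⟨j, hj⟩) j j.2)
  obtain ⟨c, hc⟩ := LinearMap.injective_iff_surjective.1 hT
    fun j => if (j : ℤ) = 0 then s * (1 / (2 * Real.pi)) else 0
  refine ⟨ext c, fun j hj => ?_⟩
  have h1 : galerkinResidual β v N 0 (ext c) j =
      if j = 0 then s * (1 / (2 * Real.pi)) else 0 := congrFun hc ⟨j, hj⟩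
  simp only [galerkinResidual] at h1 ⊢
  split_ifs at h1 ⊢ <;> linear_combination h1

end Galerkin

/-- Spectral Galerkin approximation of the acim of an analytic uniformly
expanding degree-`β` circle map: assuming a spectral gap for the transfer operator `L` in
BV and `ρ` the invariant density, there are `N₀`, `C > 0` and `ζ ∈ (0,δ]` such that for
all `N ≥ N₀` there is a unique trigonometric polynomial `ρ_N` of degree at most `N` with
`ρ_N - P_N(L ρ_N) + (1/2π) ∫₀^{2π} ρ_N = 1/(2π)` identically, and
`‖ρ_N - ρ‖_BV ≤ C N^{3/2} e^{-ζN}`. -/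
theorem galerkin_acim_convergence_analytic
    (β : ℕ) (hβ : 2 ≤ β) (lam δ : ℝ) (hlam : 1 < lam) (hδ : 0 < δ)
    (v : ℝ → ℝ) (V : ℂ → ℂ)
    (hlift : ∀ x : ℝ, v (x + 2 * Real.pi * β) = v x + 2 * Real.pi)
    (hd : ∀ x : ℝ, 0 < deriv v x ∧ deriv v x ≤ lam⁻¹)
    (hVv : ∀ x : ℝ, V x = (v x : ℂ))
    (hVhol : DifferentiableOn ℂ V {z : ℂ | |z.im| ≤ δ})
    (hV' : ∀ z : ℂ, |z.im| ≤ δ → deriv V z ≠ 0)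
    (C₁δ : ℝ)
    (hAD : ∀ z : ℂ, |z.im| ≤ δ → ‖deriv (deriv V) z‖ ≤ C₁δ * ‖deriv V z‖)
    (C₀ θ : ℝ) (hC₀ : 0 < C₀) (hθ0 : 0 < θ) (hθ1 : θ < 1)
    (hgap : ∀ ψ : ℝ → ℂ, (∀ x : ℝ, ψ (x + 2 * Real.pi) = ψ x) →
      BoundedVariationOn ψ (Set.Icc 0 (2 * Real.pi)) →
      (∫ x in (0 : ℝ)..(2 * Real.pi), ψ x) = 0 →
      ∀ n : ℕ, bvNorm ((transferOp β v)^[n] ψ) ≤ C₀ * θ ^ n * bvNorm ψ)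
    (ρ : ℝ → ℂ) (hρper : ∀ x : ℝ, ρ (x + 2 * Real.pi) = ρ x)
    (hρbv : BoundedVariationOn ρ (Set.Icc 0 (2 * Real.pi)))
    (hρfix : ∀ x : ℝ, transferOp β v ρ x = ρ x)
    (hρint : (∫ x in (0 : ℝ)..(2 * Real.pi), ρ x) = 1) :
    ∃ N₀ : ℕ, ∃ C > (0 : ℝ), ∃ ζ : ℝ, 0 < ζ ∧ ζ ≤ δ ∧
      ∀ N : ℕ, N₀ ≤ N →
        (∃! ρN : ℝ → ℂ, IsTrigPoly N ρN ∧
          ∀ x : ℝ, ρN x - fTrunc N (transferOp β v ρN) x +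
            (1 / (2 * Real.pi) : ℂ) * (∫ t in (0 : ℝ)..(2 * Real.pi), ρN t) =
              (1 / (2 * Real.pi) : ℂ)) ∧
        ∀ ρN : ℝ → ℂ, IsTrigPoly N ρN →
          (∀ x : ℝ, ρN x - fTrunc N (transferOp β v ρN) x +
            (1 / (2 * Real.pi) : ℂ) * (∫ t in (0 : ℝ)..(2 * Real.pi), ρN t) =
              (1 / (2 * Real.pi) : ℂ)) →
          bvNorm (fun x => ρN x - ρ x) ≤ C * ((N : ℝ) * Real.sqrt N) * Real.exp (-ζ * N) := by
  have hsub : {z : ℂ | |z.im| < δ} ⊆ {z : ℂ | |z.im| ≤ δ} := fun z (hz : |z.im| < δ) =>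
    hz.le
  have hV := hVhol.mono hsub
  have hv := contDiff_of_holomorphic hδ hVv hV
  obtain ⟨η, hη, α, -, C, hC, hηδ, hαη, hdecay⟩ :=
    exists_norm_fCoeff_transferOp_fMode_le hδ (inv_lt_one_of_one_lt₀ hlam) hlift hd hVv hV
  have hM : MatrixDecay β v η α C := hdecay
  obtain ⟨D, hD, hweight⟩ := hM.exists_weightNorm_le hv hαη
  obtain ⟨E, hE, htail⟩ := hM.exists_bvNorm_fTrunc_sub_le hv hlift hC hη
  have hθ : 0 < 1 - θ := sub_pos.2 hθ1
  set K : ℝ := C₀ / (1 - θ) * (E * D) with hK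
  have hK0 : 0 ≤ K := by positivity
  have hlim : Filter.Tendsto (fun N : ℕ => K * Real.exp (-(η / 2) * N)) Filter.atTop
      (nhds (K * 0)) := by
    refine Filter.Tendsto.const_mul K (Real.tendsto_exp_atBot.comp ?_)
    exact tendsto_natCast_atTop_atTop.const_mul_atTop_of_neg (by linarith)
  rw [mul_zero] at hlim
  obtain ⟨N₁, hN₁⟩ := Filter.eventually_atTop.1
    (hlim.eventually_le_const (by norm_num : (0 : ℝ) < 1 / 2))
  have key : ∀ N : ℕ, N₁ ≤ N → ∀ (s : ℂ) (c : ℤ → ℂ),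
      (∀ j ∈ Finset.Icc (-(N : ℤ)) (N : ℤ), galerkinResidual β v N s c j = 0) →
      bvNorm (fun x => trigPoly N c x - s * ρ x) ≤
        2 * K * Real.exp (-(η / 2) * N) * bvNorm (fun x => s * ρ x) := by
    intro N hN s c hc
    obtain ⟨hint, hco⟩ := coeff_eq_of_galerkinResidual_eq_zero hv hlift hc
    have hu := contDiff_trigPoly N c
    have h1 := bvNorm_sub_mul_density_le hv hlift hC₀ hθ0 hθ1 hgap hρper hρbv hρfix hρint hu
      (trigPoly_add_period N c) hint
    have hfix : fTrunc N (transferOp β v (trigPoly N c)) = trigPoly N c := by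
      rw [fTrunc_eq_trigPoly]
      funext x
      exact Finset.sum_congr rfl fun j hj => by rw [← hco j hj]
    have h2 := htail N c
    rw [hfix] at h2
    have h3 := hweight N c hco
    have hsρ : BoundedVariationOn (fun x => s * ρ x) (Set.Icc 0 (2 * Real.pi)) :=
      hρbv.const_mul s
    have hw : BoundedVariationOn (fun x => trigPoly N c x - s * ρ x)
        (Set.Icc 0 (2 * Real.pi)) := by
      have := hu.boundedVariationOn_period.fun_add (hρbv.const_mul (-s))
      simpa [sub_eq_add_neg] using this
    have h4 := bvNorm_add_le hw hsρ
    simp only [sub_add_cancel] at h4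
    have h5 : bvNorm (fun x => trigPoly N c x - s * ρ x) ≤
        K * Real.exp (-(η / 2) * N) * bvNorm (trigPoly N c) :=
      calc _ ≤ C₀ / (1 - θ) * (E * Real.exp (-(η / 2) * N) * (D * bvNorm (trigPoly N c))) := by
            refine h1.trans (mul_le_mul_of_nonneg_left (h2.trans ?_) (by positivity))
            gcongr
        _ = _ := by rw [hK]; ring
    have h6 := mul_le_mul_of_nonneg_left h4
      (by positivity : 0 ≤ K * Real.exp (-(η / 2) * N))
    have h7 := mul_le_mul_of_nonneg_right (hN₁ N hN)
      (bvNorm_nonneg fun x => trigPoly N c x - s * ρ x)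
    linarith
  have hinj : ∀ N : ℕ, N₁ ≤ N → ∀ c : ℤ → ℂ,
      (∀ j ∈ Finset.Icc (-(N : ℤ)) (N : ℤ), galerkinResidual β v N 0 c j = 0) →
      ∀ j ∈ Finset.Icc (-(N : ℤ)) (N : ℤ), c j = 0 := by
    intro N hN c hc j hj
    have h1 := key N hN 0 c hc
    simp only [zero_mul, sub_zero, bvNorm_zero, mul_zero] at h1
    have h2 := norm_fCoeff_le_bvNorm (contDiff_trigPoly N c).boundedVariationOn_period j
    rw [fCoeff_trigPoly, if_pos hj] at h2
    exact norm_le_zero_iff.1 (h2.trans h1)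
  refine ⟨max N₁ 1, 2 * K * bvNorm ρ + 1, by have := bvNorm_nonneg ρ; positivity, η / 2,
    half_pos hη, by linarith, fun N hN => ⟨?_, ?_⟩⟩
  · have hN' : N₁ ≤ N := (le_max_left _ _).trans hN
    obtain ⟨c, hc⟩ := exists_galerkinResidual_eq_zero (hinj N hN') 1
    refine ⟨trigPoly N c, ⟨⟨c, rfl⟩, (galerkin_equation_iff hv N c).2 hc⟩, ?_⟩
    rintro _ ⟨⟨d, rfl⟩, hd'⟩
    have hd'' := (galerkin_equation_iff hv N d).1 hd'
    have hdc := hinj N hN' (d - c) fun j hj => by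
      have h := galerkinResidual_sub (β := β) (v := v) N 1 1 d c j
      rwa [hd'' j hj, hc j hj, sub_self, sub_self] at h
    funext x
    exact Finset.sum_congr rfl fun j hj => by rw [sub_eq_zero.1 (hdc j hj)]; rfl
  · have hN' : N₁ ≤ N := (le_max_left _ _).trans hN
    have hN1 : (1 : ℝ) ≤ N := by exact_mod_cast (le_max_right _ _).trans hN
    rintro _ ⟨d, rfl⟩ hd'
    have h1 := key N hN' 1 d ((galerkin_equation_iff hv N d).1 hd')
    simp only [one_mul] at h1
    have h2 : (1 : ℝ) ≤ N * Real.sqrt N :=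
      one_le_mul_of_one_le_of_one_le hN1 (Real.one_le_sqrt.2 hN1)
    have h3 := bvNorm_nonneg ρ
    calc _ ≤ 2 * K * Real.exp (-(η / 2) * N) * bvNorm ρ := h1
      _ ≤ (2 * K * bvNorm ρ + 1) * 1 * Real.exp (-(η / 2) * N) := by
        nlinarith [Real.exp_pos (-(η / 2) * N)]
      _ ≤ _ := by gcongr
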